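/- Let α > 0, let ν be a Borel probability measure on ℝ₊, let T, L > 1 and r > 0, and let ε, l, p, κ, γ, M, N be as in the good-path properties. Suppose a processor-sharing path satisfies the level-(ε, l, κ, γ, M) properties (for r, T, L), and suppose that for some integer 0 ≤ m ≤ ⌊rT⌋ the initial shifted workload satisfies ⟨χ, μ̄^{r,m}(0)⟩ ≤ γ/2. Then sup_{t∈[0,L]} ⟨1, μ̄^{r,m}(t)⟩ ≤ 2ε. -/

import Mathlib

open MeasureTheory Filter Set
noncomputable section
namespace PSQ

/-- ⟨g, ζ⟩ = ∫ g dζ -/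
def pair (g : ℝ → ℝ) (ζ : Measure ℝ) : ℝ := ∫ x, g x ∂ζ

/-- total mass ⟨1, ζ⟩ of a finite measure, as a real number -/
def mass (ζ : Measure ℝ) : ℝ := (ζ Set.univ).toReal

/-- truncated Dirac measure δ⁺ₓ -/
def dplus (x : ℝ) : Measure ℝ := if 0 < x then Measure.dirac x else 0

/-- positive part x⁺ -/
def pos (x : ℝ) : ℝ := max x 0

/-- the arrival counting process E(t) = sup{i : U i ≤ t} -/
def Ecount (U : ℕ → ℝ) (t : ℝ) : ℕ := sSup {i : ℕ | U i ≤ t}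

/-- the standing hypotheses on the data of a pathwise processor sharing queue:
nondecreasing arrival times with `U 0 = 0`, `U 1 > 0`, `U i → ∞`, and strictly positive
service times and initial service times. -/
def QueueHyps (U v : ℕ → ℝ) (Z0 : ℕ) (vt : ℕ → ℝ) : Prop :=
  U 0 = 0 ∧ Monotone U ∧ 0 < U 1 ∧ Tendsto U atTop atTop ∧
    (∀ i, 1 ≤ i → 0 < v i) ∧ (∀ j, 1 ≤ j → 0 < vt j)

/-- the defining equations of the state descriptor μ and the cumulative service per
job S:  `S t = ∫_0^t φ(⟨1, μ(s)⟩) ds` (recall `(0:ℝ)⁻¹ = 0` in Lean, matching φ(0)=0)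
and `μ(t) = Σ_j δ⁺_{(ṽ_j - S(t))⁺} + Σ_{i ≤ E(t)} δ⁺_{(v_i - S(t) + S(U_i))⁺}`. -/
def StateEqns (U v : ℕ → ℝ) (Z0 : ℕ) (vt : ℕ → ℝ)
    (μ : ℝ → Measure ℝ) (S : ℝ → ℝ) : Prop :=
  ∀ t, 0 ≤ t →
    (S t = ∫ s in (0:ℝ)..t, (mass (μ s))⁻¹) ∧
    μ t = (∑ j ∈ Finset.range Z0, dplus (pos (vt (j+1) - S t)))
        + ∑ i ∈ Finset.range (Ecount U t), dplus (pos (v (i+1) - S t + S (U (i+1))))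

/-- fluid scaled state descriptor μ̄^r(t) = r⁻¹ μ(rt) -/
def fmu (μ : ℝ → Measure ℝ) (r t : ℝ) : Measure ℝ := ENNReal.ofReal (1/r) • μ (r*t)

/-- fluid scaled arrival process Ē^r(t) = r⁻¹ E(rt) -/
def fE (U : ℕ → ℝ) (r t : ℝ) : ℝ := (Ecount U (r*t) : ℝ) / r

/-- fluid scaled cumulative service S̄^r_{t,t'} = S(r t') - S(r t) -/
def fS (S : ℝ → ℝ) (r t t' : ℝ) : ℝ := S (r*t') - S (r*t)

end PSQ
end

namespace PSQ

/-- The constraints tying together the constants of the good-path properties: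
`ε ∈ (0,1)`, `l, p, κ, γ > 0`, `M > 1`, `l < ε/(32α)`, `κ < l/(2M)`,
`γ < (κε/4) ∧ (l/4)`. -/
def GoodConsts (α ε l p κ γ M : ℝ) : Prop :=
  ε ∈ Set.Ioo (0:ℝ) 1 ∧ 0 < l ∧ 0 < p ∧ 0 < κ ∧ 0 < γ ∧ 1 < M ∧
    l < ε/(32*α) ∧ κ < l/(2*M) ∧ γ < min (κ*ε/4) (l/4)

/-- A processor sharing path satisfies the level-(ε, l, κ, γ, M) good-path properties
(for r, T, L), with `N = ⌈64M²/(κε²)⌉ + 1`. -/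
def GoodPath (U v : ℕ → ℝ) (μ : ℝ → Measure ℝ) (ν : Measure ℝ)
    (T L r ε l p κ γ M : ℝ) : Prop :=
  ∀ m : ℕ, m ≤ ⌊r * T⌋₊ →
    (∀ t ∈ Set.Icc (0:ℝ) L, fE U r ((m:ℝ) + t + l) - fE U r ((m:ℝ) + t) ≤ ε/16) ∧
    (∀ t ∈ Set.Icc (0:ℝ) L,
      max (max (mass (fmu μ r ((m:ℝ)+t))) (pair id (fmu μ r ((m:ℝ)+t))))
        (pair (fun x => x ^ ((1:ℝ)+p)) (fmu μ r ((m:ℝ)+t))) ≤ M) ∧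
    (∀ x : ℝ, 0 ≤ x → ((fmu μ r 0) (Set.Icc x (x+κ))).toReal ≤ ε/4) ∧
    (∀ t ∈ Set.Icc (0:ℝ) L,
      |pair id (fmu μ r ((m:ℝ)+t)) - pair id (fmu μ r (m:ℝ))| ≤ γ/4) ∧
    (∀ t ∈ Set.Icc (0:ℝ) L, ∀ k : ℕ, k ≤ ⌈64*M^2/(κ*ε^2)⌉₊ + 1 →
      (1/r) * (∑ i ∈ Finset.Ioc (Ecount U (r*((m:ℝ)+t))) (Ecount U (r*((m:ℝ)+t+l))),
          if (k:ℝ)*κ ≤ v i ∧ v i < ((k:ℝ)+1)*κ then (1:ℝ) else 0)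
        ≤ (ε/8) * (ν (Set.Ico (((k:ℝ)-1/2)*κ) (((k:ℝ)+3/2)*κ))).toReal)

end PSQ


namespace PSQ

open Classical in
/-- The number of initial jobs whose residual service time, after `x` units of cumulative
service per job, lies in `B`. -/
noncomputable def initCount (vt : ℕ → ℝ) (Z0 : ℕ) (x : ℝ) (B : Set ℝ) : ℕ :=
  ((Finset.range Z0).filter fun j => vt (j + 1) - x ∈ B).card

open Classical in
/-- The number of arrivals with index in `(a, b]` whose residual service time, when the
cumulative service per job equals `x`, lies in `B`. -/
noncomputable def arrCount (v S : ℕ → ℝ) (a b : ℕ) (x : ℝ) (B : Set ℝ) : ℕ :=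
  ((Finset.Ioc a b).filter fun i => v i - x + S i ∈ B).card

theorem le_Ecount_iff {U : ℕ → ℝ} (h0 : U 0 = 0) (hmono : Monotone U)
    (htop : Tendsto U atTop atTop) {t : ℝ} (ht : 0 ≤ t) (i : ℕ) :
    i ≤ Ecount U t ↔ U i ≤ t := by
  have hne : ({i : ℕ | U i ≤ t}).Nonempty := ⟨0, by simpa [h0] using ht⟩
  have hbdd : BddAbove {i : ℕ | U i ≤ t} := by
    obtain ⟨n, hn⟩ := (htop.eventually_gt_atTop t).exists
    exact ⟨n, fun i hi => le_of_not_gt fun h =>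
      absurd (hmono h.le) (not_le.mpr (lt_of_le_of_lt hi hn))⟩
  constructor
  · intro h
    exact (hmono h).trans (Nat.sSup_mem hne hbdd)
  · intro h
    exact le_csSup hbdd h

open Classical in
theorem dplus_pos_apply (x : ℝ) {B : Set ℝ} (hB : MeasurableSet B) :
    dplus (pos x) B = if x ∈ B ∩ Set.Ioi 0 then 1 else 0 := by
  unfold dplus pos
  by_cases hx : 0 < x
  · rw [max_eq_left hx.le, if_pos hx, Measure.dirac_apply' _ hB]
    by_cases hxB : x ∈ B <;> simp [hxB, hx]
  · simp [max_eq_right (not_lt.mp hx), hx]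

theorem sum_range_shift_eq_sum_Ioc {β : Type*} [AddCommMonoid β] (f : ℕ → β) (n : ℕ) :
    ∑ i ∈ Finset.range n, f (i + 1) = ∑ i ∈ Finset.Ioc 0 n, f i := by
  rw [Finset.range_eq_Ico, Finset.sum_Ico_add' f 0 n 1]
  rfl

theorem StateEqns.measure_toReal {U v : ℕ → ℝ} {Z0 : ℕ} {vt : ℕ → ℝ} {μ : ℝ → Measure ℝ}
    {S : ℝ → ℝ} (h : StateEqns U v Z0 vt μ S) {t : ℝ} (ht : 0 ≤ t) {B : Set ℝ}
    (hB : MeasurableSet B) :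
    (μ t B).toReal = initCount vt Z0 (S t) (B ∩ Set.Ioi 0)
      + arrCount v (S ∘ U) 0 (Ecount U t) (S t) (B ∩ Set.Ioi 0) := by
  classical
  have : μ t B = ((initCount vt Z0 (S t) (B ∩ Set.Ioi 0)
      + arrCount v (S ∘ U) 0 (Ecount U t) (S t) (B ∩ Set.Ioi 0) : ℕ) : ENNReal) := by
    rw [(h t ht).2, sum_range_shift_eq_sum_Ioc (fun i => dplus (pos (v i - S t + S (U i))))]
    simp only [Measure.add_apply, Measure.finsetSum_apply, dplus_pos_apply _ hB]
    simp only [initCount, arrCount, Finset.sum_boole, Nat.cast_add, Function.comp]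
    congr!
  rw [this, ENNReal.toReal_natCast]
  push_cast
  rfl

theorem integrable_id_dplus (x : ℝ) : Integrable id (dplus x) := by
  unfold dplus
  split_ifs
  · exact integrable_dirac (by simp)
  · exact integrable_zero_measure

instance isFiniteMeasure_dplus (x : ℝ) : IsFiniteMeasure (dplus x) := by
  unfold dplus
  split_ifs <;> infer_instance

theorem StateEqns.isFiniteMeasure {U v : ℕ → ℝ} {Z0 : ℕ} {vt : ℕ → ℝ} {μ : ℝ → Measure ℝ}
    {S : ℝ → ℝ} (h : StateEqns U v Z0 vt μ S) {t : ℝ} (ht : 0 ≤ t) :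
    IsFiniteMeasure (μ t) := by
  rw [(h t ht).2]
  infer_instance

/-- Markov's inequality for the residual service times. -/
theorem StateEqns.mul_count_le_pair {U v : ℕ → ℝ} {Z0 : ℕ} {vt : ℕ → ℝ} {μ : ℝ → Measure ℝ}
    {S : ℝ → ℝ} (h : StateEqns U v Z0 vt μ S) {t : ℝ} (ht : 0 ≤ t) {c : ℝ} (hc : 0 ≤ c) :
    c * ((initCount vt Z0 (S t) (Set.Ioi c) : ℝ)
      + arrCount v (S ∘ U) 0 (Ecount U t) (S t) (Set.Ioi c)) ≤ pair id (μ t) := by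
  have := h.isFiniteMeasure ht
  have hint : Integrable id (μ t) := by
    rw [(h t ht).2, integrable_add_measure, integrable_finsetSum_measure,
      integrable_finsetSum_measure]
    exact ⟨fun _ _ => integrable_id_dplus _, fun _ _ => integrable_id_dplus _⟩
  have hnn : 0 ≤ᵐ[μ t] (id : ℝ → ℝ) := by
    have h0 := h.measure_toReal ht (measurableSet_Iio (a := (0 : ℝ)))
    have hemp : Set.Iio (0 : ℝ) ∩ Set.Ioi 0 = ∅ := by
      ext x
      simp only [Set.mem_inter_iff, Set.mem_Iio, Set.mem_Ioi, Set.mem_empty_iff_false, iff_false]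
      intro hx
      linarith [hx.1, hx.2]
    rw [hemp] at h0
    simp only [initCount, arrCount, Set.mem_empty_iff_false, Finset.filter_false,
      Finset.card_empty, Nat.cast_zero, add_zero] at h0
    rw [ENNReal.toReal_eq_zero_iff] at h0
    rcases h0 with h0 | h0
    · rw [Filter.EventuallyLE, ae_iff]
      convert h0 using 2
      ext x
      simp
    · exact absurd h0 (measure_ne_top _ _)
  have hM := mul_meas_ge_le_integral_of_nonneg hnn hint c
  refine le_trans (mul_le_mul_of_nonneg_left ?_ hc) hM
  have hset : {x : ℝ | c < x} ∩ Set.Ioi 0 = Set.Ioi c := by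
    ext x
    simp only [Set.mem_inter_iff, Set.mem_ofPred_eq, Set.mem_Ioi, and_iff_left_iff_imp]
    intro hx
    linarith
  have h1 := h.measure_toReal ht (measurableSet_Ioi (a := c))
  rw [show (Set.Ioi c ∩ Set.Ioi (0 : ℝ)) = Set.Ioi c from hset] at h1
  rw [← h1]
  exact measureReal_mono (Set.Ioi_subset_Ici_self)

theorem StateEqns.mass_eq {U v : ℕ → ℝ} {Z0 : ℕ} {vt : ℕ → ℝ} {μ : ℝ → Measure ℝ}
    {S : ℝ → ℝ} (h : StateEqns U v Z0 vt μ S) {t : ℝ} (ht : 0 ≤ t) :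
    mass (μ t) = initCount vt Z0 (S t) (Set.Ioi 0)
      + arrCount v (S ∘ U) 0 (Ecount U t) (S t) (Set.Ioi 0) := by
  unfold mass
  rw [h.measure_toReal ht MeasurableSet.univ, Set.univ_inter]

theorem StateEqns.inv_mass_mem_Icc {U v : ℕ → ℝ} {Z0 : ℕ} {vt : ℕ → ℝ} {μ : ℝ → Measure ℝ}
    {S : ℝ → ℝ} (h : StateEqns U v Z0 vt μ S) {t : ℝ} (ht : 0 ≤ t) :
    (mass (μ t))⁻¹ ∈ Set.Icc (0 : ℝ) 1 := by
  rw [h.mass_eq ht, ← Nat.cast_add]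
  exact ⟨by positivity, Nat.cast_inv_le_one _⟩

theorem measurable_initCount (vt : ℕ → ℝ) (Z0 : ℕ) :
    Measurable fun x => (initCount vt Z0 x (Set.Ioi 0) : ℝ) := by
  classical
  simp only [initCount, ← Finset.sum_boole]
  refine Finset.measurable_sum _ fun j _ => Measurable.ite ?_ measurable_const measurable_const
  exact measurableSet_lt measurable_const (measurable_const.sub measurable_id)

theorem measurable_arrCount (v S : ℕ → ℝ) (n : ℕ) :
    Measurable fun x => (arrCount v S 0 n x (Set.Ioi 0) : ℝ) := by
  classical
  simp only [arrCount, ← Finset.sum_boole]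
  refine Finset.measurable_sum _ fun j _ => Measurable.ite ?_ measurable_const measurable_const
  exact measurableSet_lt measurable_const
    ((measurable_const.sub measurable_id).add measurable_const)

theorem StateEqns.measurable_service {U v : ℕ → ℝ} {Z0 : ℕ} {vt : ℕ → ℝ} {μ : ℝ → Measure ℝ}
    {S : ℝ → ℝ} (h : StateEqns U v Z0 vt μ S) :
    Measurable fun t => S (max t 0) := by
  refine measurable_of_Ioi fun c => Set.OrdConnected.measurableSet ?_
  have hnn : ∀ a b : ℝ, 0 ≤ a → a ≤ b → 0 ≤ ∫ s in a..b, (mass (μ s))⁻¹ := fun a b ha hab =>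
    intervalIntegral.integral_nonneg hab fun s hs => (h.inv_mass_mem_Icc (ha.trans hs.1)).1
  by_cases hc : c < 0
  · convert Set.ordConnected_univ
    ext t
    simp only [Set.mem_preimage, Set.mem_Ioi, Set.mem_univ, iff_true]
    rw [(h _ (le_max_right t 0)).1]
    exact lt_of_lt_of_le hc (hnn _ _ le_rfl (le_max_right t 0))
  refine ⟨fun a ha b hb x hx => ?_⟩
  simp only [Set.mem_preimage, Set.mem_Ioi] at ha hb ⊢
  rw [(h _ (le_max_right _ _)).1] at ha hb ⊢
  have hax : max a 0 ≤ max x 0 := max_le_max_right 0 hx.1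
  have hxb : max x 0 ≤ max b 0 := max_le_max_right 0 hx.2
  have hib : IntervalIntegrable (fun s => (mass (μ s))⁻¹) volume 0 (max b 0) := by
    by_contra hcon
    rw [intervalIntegral.integral_undef hcon] at hb
    exact hc hb
  have hsub : ∀ y z : ℝ, 0 ≤ y → y ≤ z → z ≤ max b 0 →
      IntervalIntegrable (fun s => (mass (μ s))⁻¹) volume y z := fun y z hy hyz hz => by
    refine hib.mono_set ?_
    rw [Set.uIcc_of_le hyz, Set.uIcc_of_le (le_max_right b 0)]
    exact Set.Icc_subset_Icc hy hz
  rw [← intervalIntegral.integral_add_adjacent_intervals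
    (hsub 0 (max a 0) le_rfl (le_max_right a 0) (hax.trans hxb))
    (hsub (max a 0) (max x 0) (le_max_right a 0) hax hxb)]
  linarith [hnn (max a 0) (max x 0) (le_max_right a 0) hax]

theorem StateEqns.intervalIntegrable {U v : ℕ → ℝ} {Z0 : ℕ} {vt : ℕ → ℝ} {μ : ℝ → Measure ℝ}
    {S : ℝ → ℝ} (hq : QueueHyps U v Z0 vt) (h : StateEqns U v Z0 vt μ S)
    {a b : ℝ} (ha : 0 ≤ a) (hab : a ≤ b) :
    IntervalIntegrable (fun s => (mass (μ s))⁻¹) volume a b := by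
  obtain ⟨h0, hmono, -, htop, -, -⟩ := hq
  have hE : Measurable fun t : ℝ => Ecount U (max t 0) := by
    refine Monotone.measurable fun s t hst => ?_
    rw [le_Ecount_iff h0 hmono htop (le_max_right t 0)]
    exact ((le_Ecount_iff h0 hmono htop (le_max_right s 0) _).1 le_rfl).trans
      (max_le_max_right 0 hst)
  have hmeas : Measurable fun t : ℝ => (mass (μ (max t 0)))⁻¹ := by
    have hF : Measurable fun q : ℝ × ℕ =>
        (arrCount v (S ∘ U) 0 q.2 q.1 (Set.Ioi 0) : ℝ) :=
      measurable_from_prod_countable_left fun n => measurable_arrCount v (S ∘ U) n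
    have hmass : (fun t : ℝ => (mass (μ (max t 0)))⁻¹) = fun t =>
        ((initCount vt Z0 (S (max t 0)) (Set.Ioi 0) : ℝ)
          + arrCount v (S ∘ U) 0 (Ecount U (max t 0)) (S (max t 0)) (Set.Ioi 0))⁻¹ :=
      funext fun t => by rw [h.mass_eq (le_max_right t 0)]
    have h1 := (measurable_initCount vt Z0).comp h.measurable_service
    have h2 := hF.comp (h.measurable_service.prodMk hE)
    rw [hmass]
    exact (h1.add h2).inv
  have hint : IntervalIntegrable (fun t : ℝ => (mass (μ (max t 0)))⁻¹) volume a b := by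
    refine (intervalIntegrable_const (c := (1 : ℝ))).mono_fun hmeas.aestronglyMeasurable ?_
    refine Filter.Eventually.of_forall fun t => ?_
    have := h.inv_mass_mem_Icc (le_max_right t 0)
    change ‖(mass (μ (max t 0)))⁻¹‖ ≤ ‖(1 : ℝ)‖
    rw [Real.norm_of_nonneg this.1, norm_one]
    exact this.2
  refine hint.congr fun t ht => ?_
  rw [Set.uIoc_of_le hab] at ht
  simp only [max_eq_left (ha.trans ht.1.le)]

theorem StateEqns.service_sub {U v : ℕ → ℝ} {Z0 : ℕ} {vt : ℕ → ℝ} {μ : ℝ → Measure ℝ}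
    {S : ℝ → ℝ} (hq : QueueHyps U v Z0 vt) (h : StateEqns U v Z0 vt μ S)
    {a b : ℝ} (ha : 0 ≤ a) (hab : a ≤ b) :
    S b - S a = ∫ s in a..b, (mass (μ s))⁻¹ := by
  rw [(h a ha).1, (h b (ha.trans hab)).1, ← intervalIntegral.integral_add_adjacent_intervals
    (h.intervalIntegrable hq le_rfl ha) (h.intervalIntegrable hq ha hab)]
  ring

theorem StateEqns.service_mono {U v : ℕ → ℝ} {Z0 : ℕ} {vt : ℕ → ℝ} {μ : ℝ → Measure ℝ}
    {S : ℝ → ℝ} (hq : QueueHyps U v Z0 vt) (h : StateEqns U v Z0 vt μ S)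
    {a b : ℝ} (ha : 0 ≤ a) (hab : a ≤ b) : S a ≤ S b := by
  have h1 := h.service_sub hq ha hab
  have h2 : 0 ≤ ∫ s in a..b, (mass (μ s))⁻¹ :=
    intervalIntegral.integral_nonneg hab fun s hs => (h.inv_mass_mem_Icc (ha.trans hs.1)).1
  linarith

/-- While the queue is nonempty and of length at most `C`, each job is served at rate at
least `1 / C`. -/
theorem StateEqns.div_le_service_sub {U v : ℕ → ℝ} {Z0 : ℕ} {vt : ℕ → ℝ}
    {μ : ℝ → Measure ℝ} {S : ℝ → ℝ} (hq : QueueHyps U v Z0 vt)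
    (h : StateEqns U v Z0 vt μ S) {a b C : ℝ} (ha : 0 ≤ a) (hab : a ≤ b)
    (hpos : ∀ s ∈ Set.Icc a b, 0 < mass (μ s)) (hC : ∀ s ∈ Set.Icc a b, mass (μ s) ≤ C) :
    (b - a) / C ≤ S b - S a := by
  rw [h.service_sub hq ha hab]
  have := intervalIntegral.integral_mono_on hab (intervalIntegrable_const (c := C⁻¹))
    (h.intervalIntegrable hq ha hab)
    (fun s hs => inv_anti₀ (hpos s hs) (hC s hs))
  simpa [div_eq_mul_inv] using this

theorem initCount_le_initCount {vt : ℕ → ℝ} {Z0 : ℕ} {x y : ℝ} {B B' : Set ℝ}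
    (hB : ∀ z ∈ B, z + (x - y) ∈ B') : initCount vt Z0 x B ≤ initCount vt Z0 y B' := by
  classical
  refine Finset.card_le_card fun j hj => ?_
  rw [Finset.mem_filter] at hj ⊢
  refine ⟨hj.1, ?_⟩
  convert hB _ hj.2 using 1
  ring

theorem arrCount_le_arrCount {v S : ℕ → ℝ} {a b b' : ℕ} {x y : ℝ} {B B' : Set ℝ}
    (hb : b ≤ b') (hB : ∀ z ∈ B, z + (x - y) ∈ B') :
    arrCount v S a b x B ≤ arrCount v S a b' y B' := by
  classical
  refine Finset.card_le_card fun j hj => ?_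
  rw [Finset.mem_filter, Finset.mem_Ioc] at hj ⊢
  refine ⟨⟨hj.1.1, hj.1.2.trans hb⟩, ?_⟩
  convert hB _ hj.2 using 1
  ring

theorem arrCount_le_sub (v S : ℕ → ℝ) (a b : ℕ) (x : ℝ) (B : Set ℝ) :
    arrCount v S a b x B ≤ b - a := by
  classical
  unfold arrCount
  exact (Finset.card_filter_le _ _).trans (Nat.card_Ioc a b).le

theorem arrCount_add_arrCount (v S : ℕ → ℝ) {a b c : ℕ} (hab : a ≤ b) (hbc : b ≤ c) (x : ℝ)
    (B : Set ℝ) : arrCount v S a b x B + arrCount v S b c x B = arrCount v S a c x B := by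
  classical
  unfold arrCount
  rw [← Finset.Ioc_union_Ioc_eq_Ioc hab hbc, Finset.filter_union, Finset.card_union_of_disjoint]
  exact Finset.disjoint_filter_filter (Finset.Ioc_disjoint_Ioc_of_le le_rfl)

theorem initCount_le_union {vt : ℕ → ℝ} {Z0 : ℕ} {x : ℝ} {B B₁ B₂ : Set ℝ}
    (hB : B ⊆ B₁ ∪ B₂) : initCount vt Z0 x B ≤ initCount vt Z0 x B₁ + initCount vt Z0 x B₂ := by
  classical
  unfold initCount
  refine (Finset.card_le_card ?_).trans (Finset.card_union_le _ _)
  intro j hj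
  simp only [Finset.mem_union, Finset.mem_filter] at hj ⊢
  rcases hB hj.2 with h | h
  · exact Or.inl ⟨hj.1, h⟩
  · exact Or.inr ⟨hj.1, h⟩

theorem arrCount_le_union {v S : ℕ → ℝ} {a b : ℕ} {x : ℝ} {B B₁ B₂ : Set ℝ}
    (hB : B ⊆ B₁ ∪ B₂) :
    arrCount v S a b x B ≤ arrCount v S a b x B₁ + arrCount v S a b x B₂ := by
  classical
  unfold arrCount
  refine (Finset.card_le_card ?_).trans (Finset.card_union_le _ _)
  intro j hj
  simp only [Finset.mem_union, Finset.mem_filter] at hj ⊢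
  rcases hB hj.2 with h | h
  · exact Or.inl ⟨hj.1, h⟩
  · exact Or.inr ⟨hj.1, h⟩

/-- The overlapping windows `[(k - 1/2)κ, (k + 3/2)κ)` cover each point at most twice. -/
theorem sum_measure_windows_le_two (ν : Measure ℝ) [IsProbabilityMeasure ν] {κ : ℝ}
    (hκ : 0 < κ) (n : ℕ) :
    ∑ k ∈ Finset.range n, (ν (Set.Ico (((k : ℝ) - 1/2) * κ) (((k : ℝ) + 3/2) * κ))).toReal
      ≤ 2 := by
  have hstep : ∀ x y : ℝ, x ≤ y →
      (ν (Set.Ico x y)).toReal = (ν (Set.Iio y)).toReal - (ν (Set.Iio x)).toReal := by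
    intro x y hxy
    have h := measureReal_union (μ := ν) (s₁ := Set.Iio x) (s₂ := Set.Ico x y)
      (Set.disjoint_left.2 fun z hz hz' => absurd hz'.1 (not_le.2 hz)) measurableSet_Ico
    rw [Set.Iio_union_Ico_eq_Iio hxy] at h
    simp only [Measure.real] at h
    linarith
  have hind : ∑ k ∈ Finset.range n,
      (ν (Set.Ico (((k : ℝ) - 1/2) * κ) (((k : ℝ) + 3/2) * κ))).toReal
      ≤ (ν (Set.Iio (((n : ℝ) - 1/2) * κ))).toReal
        + (ν (Set.Iio (((n : ℝ) + 1/2) * κ))).toReal := by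
    induction n with
    | zero => simp only [Finset.range_zero, Finset.sum_empty]; positivity
    | succ n ih =>
      rw [Finset.sum_range_succ, hstep _ _ (by nlinarith)]
      push_cast
      rw [show ((n : ℝ) + 1 - 1/2) = n + 1/2 by ring, show ((n : ℝ) + 1 + 1/2) = n + 3/2 by ring]
      linarith
  have h1 : ∀ s : Set ℝ, (ν s).toReal ≤ 1 := fun s => measureReal_le_one
  linarith [h1 (Set.Iio (((n : ℝ) - 1/2) * κ)), h1 (Set.Iio (((n : ℝ) + 1/2) * κ))]

/-- If consecutive integer intervals `[K j, K (j + 1) + 2)` advance by at least two at each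
step, then their sums cover every index at most twice. -/
theorem sum_le_of_overlapping_intervals {f c : ℕ → ℝ} (hf : ∀ k, 0 ≤ f k) {K : ℕ → ℕ} {J : ℕ}
    (hK : ∀ j < J, K j + 2 ≤ K (j + 1))
    (hc : ∀ j < J, c j ≤ ∑ k ∈ Finset.Ico (K j) (K (j + 1) + 2), f k) :
    ∑ j ∈ Finset.range J, c j
      ≤ ∑ k ∈ Finset.range (K J), f k + ∑ k ∈ Finset.range (K J + 2), f k := by
  induction J with
  | zero =>
    rw [Finset.range_zero, Finset.sum_empty]
    exact add_nonneg (Finset.sum_nonneg fun _ _ => hf _) (Finset.sum_nonneg fun _ _ => hf _)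
  | succ J ih =>
    have ih' := ih (fun j hj => hK j (hj.trans (Nat.lt_succ_self J)))
      (fun j hj => hc j (hj.trans (Nat.lt_succ_self J)))
    have hKJ := hK J (Nat.lt_succ_self J)
    have hcJ := hc J (Nat.lt_succ_self J)
    rw [Finset.sum_range_succ]
    have h1 : ∑ k ∈ Finset.range (K J + 2), f k ≤ ∑ k ∈ Finset.range (K (J + 1)), f k :=
      Finset.sum_le_sum_of_subset_of_nonneg (Finset.range_subset_range.2 hKJ) fun _ _ _ => hf _
    have h2 := Finset.sum_range_add_sum_Ico f (show K J ≤ K (J + 1) + 2 by omega)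
    linarith

/-- Arrivals during `(a, b]` whose residual service time at a later time, when the cumulative
service is `x`, lies in `(0, κ]` have service times in few bins of width `κ`. -/
theorem arrCount_le_sum_bins {U v : ℕ → ℝ} {Z0 : ℕ} {vt : ℕ → ℝ} {μ : ℝ → Measure ℝ}
    {S : ℝ → ℝ} (hq : QueueHyps U v Z0 vt) (h : StateEqns U v Z0 vt μ S) {a b x κ : ℝ}
    (ha : 0 ≤ a) (hab : a ≤ b) (hb : S b ≤ x) (hκ : 0 < κ) :
    (arrCount v (S ∘ U) (Ecount U a) (Ecount U b) x (Set.Ioc 0 κ) : ℝ)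
      ≤ ∑ k ∈ Finset.Ico ⌊(x - S b) / κ⌋₊ (⌊(x - S a) / κ⌋₊ + 2),
        ∑ i ∈ Finset.Ioc (Ecount U a) (Ecount U b),
          if (k : ℝ) * κ ≤ v i ∧ v i < ((k : ℝ) + 1) * κ then (1 : ℝ) else 0 := by
  classical
  obtain ⟨h0, hmono, -, htop, -, -⟩ := id hq
  rw [Finset.sum_comm, arrCount, ← Finset.sum_boole]
  refine Finset.sum_le_sum fun i hi => ?_
  rw [Finset.mem_Ioc] at hi
  have hUa : a < U i := by
    rw [← not_le, ← le_Ecount_iff h0 hmono htop ha]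
    omega
  have hUb : U i ≤ b := (le_Ecount_iff h0 hmono htop (ha.trans hab) i).1 hi.2
  have hSa := h.service_mono hq ha hUa.le
  have hSb := h.service_mono hq (ha.trans hUa.le) hUb
  have hnn : ∀ k : ℕ, (0 : ℝ) ≤
      if (k : ℝ) * κ ≤ v i ∧ v i < ((k : ℝ) + 1) * κ then (1 : ℝ) else 0 := fun k => by
    split_ifs <;> norm_num
  split_ifs with hres
  swap
  · exact Finset.sum_nonneg fun k _ => hnn k
  obtain ⟨hlo, hhi⟩ := hres
  simp only [Function.comp] at hlo hhi
  have hvi : 0 ≤ v i / κ := div_nonneg (by linarith) hκ.le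
  have hbin : (⌊v i / κ⌋₊ : ℝ) * κ ≤ v i ∧ v i < ((⌊v i / κ⌋₊ : ℝ) + 1) * κ :=
    ⟨(le_div_iff₀ hκ).1 (Nat.floor_le hvi), (div_lt_iff₀ hκ).1 (Nat.lt_floor_add_one _)⟩
  have hmem : ⌊v i / κ⌋₊ ∈ Finset.Ico ⌊(x - S b) / κ⌋₊ (⌊(x - S a) / κ⌋₊ + 2) := by
    rw [Finset.mem_Ico]
    constructor
    · exact Nat.floor_le_floor (div_le_div_of_nonneg_right (by linarith) hκ.le)
    · have hle : v i / κ ≤ (x - S a) / κ + 1 := by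
        rw [← div_self hκ.ne', ← add_div]
        exact div_le_div_of_nonneg_right (by linarith) hκ.le
      have := Nat.floor_le_floor hle
      rw [Nat.floor_add_one (div_nonneg (by linarith) hκ.le)] at this
      omega
  refine le_trans ?_ (Finset.single_le_sum (fun k _ => hnn k) hmem)
  rw [if_pos hbin]

theorem floor_div_add_two_le {κ x y : ℝ} (hκ : 0 < κ) (hx : 0 ≤ x) (hxy : x + 2 * κ ≤ y) :
    ⌊x / κ⌋₊ + 2 ≤ ⌊y / κ⌋₊ := by
  have hle : x / κ + (2 : ℕ) ≤ y / κ := by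
    rw [le_div_iff₀ hκ, add_mul, div_mul_cancel₀ _ hκ.ne']
    exact_mod_cast hxy
  rw [← Nat.floor_add_natCast (div_nonneg hx hκ.le)]
  exact Nat.floor_le_floor hle

theorem Ecount_mono {U : ℕ → ℝ} (h0 : U 0 = 0) (hmono : Monotone U)
    (htop : Tendsto U atTop atTop) {a b : ℝ} (ha : 0 ≤ a) (hab : a ≤ b) :
    Ecount U a ≤ Ecount U b :=
  (le_Ecount_iff h0 hmono htop (ha.trans hab) _).2
    (((le_Ecount_iff h0 hmono htop ha _).1 le_rfl).trans hab)

theorem Ecount_zero {U : ℕ → ℝ} (h0 : U 0 = 0) (hmono : Monotone U) (h1 : 0 < U 1)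
    (htop : Tendsto U atTop atTop) : Ecount U 0 = 0 := by
  by_contra hne
  exact absurd ((le_Ecount_iff h0 hmono htop le_rfl 1).1 (Nat.one_le_iff_ne_zero.2 hne))
    (not_le.2 h1)

theorem sum_range_arrCount (v S : ℕ → ℝ) (x : ℝ) (B : Set ℝ) {e : ℕ → ℕ} {J : ℕ}
    (he : ∀ j < J, e (j + 1) ≤ e j) :
    e J ≤ e 0 ∧
      ∑ j ∈ Finset.range J, arrCount v S (e (j + 1)) (e j) x B = arrCount v S (e J) (e 0) x B := by
  induction J with
  | zero => simp [arrCount]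
  | succ J ih =>
    obtain ⟨ih1, ih2⟩ := ih fun j hj => he j (hj.trans (Nat.lt_succ_self J))
    have hJ := he J (Nat.lt_succ_self J)
    refine ⟨hJ.trans ih1, ?_⟩
    rw [Finset.sum_range_succ, ih2, add_comm, arrCount_add_arrCount _ _ hJ ih1]

/-- Few jobs are left from before a window of length `lam` ending at `a` if this window starts
before time zero, or the queue idles in it, or jobs receive more than `B` service from the start
of this window up to time `τ`. -/
theorem old_jobs_le {U v : ℕ → ℝ} {Z0 : ℕ} {vt : ℕ → ℝ} {μ : ℝ → Measure ℝ}
    {S : ℝ → ℝ} (hq : QueueHyps U v Z0 vt) (h : StateEqns U v Z0 vt μ S)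
    {a τ lam κ A I W B : ℝ} (ha : 0 ≤ a) (haτ : a ≤ τ) (hlam : 0 < lam) (hB : 0 < B)
    (hI : 0 ≤ I) (hWI : W ≤ B * I)
    (hinit : (initCount vt Z0 (S τ) (Set.Ioc 0 κ) : ℝ) ≤ I)
    (harr : ∀ b ∈ Set.Icc 0 τ, (Ecount U (b + lam) : ℝ) - Ecount U b ≤ A)
    (hwork : ∀ b ∈ Set.Icc 0 τ, pair id (μ b) ≤ W)
    (hcases : lam ≤ a → (∀ s ∈ Set.Icc (a - lam) a, 0 < mass (μ s)) → B < S τ - S (a - lam)) :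
    (initCount vt Z0 (S τ) (Set.Ioc 0 κ) : ℝ)
      + arrCount v (S ∘ U) 0 (Ecount U a) (S τ) (Set.Ioc 0 κ) ≤ I + A := by
  obtain ⟨h0, hmono, h1, htop, -, -⟩ := id hq
  by_cases hal : lam ≤ a
  swap
  · have hA := harr 0 ⟨le_rfl, ha.trans haτ⟩
    rw [Ecount_zero h0 hmono h1 htop, zero_add, Nat.cast_zero, sub_zero] at hA
    have h2 : arrCount v (S ∘ U) 0 (Ecount U a) (S τ) (Set.Ioc 0 κ) ≤ Ecount U lam :=
      (arrCount_le_sub _ _ _ _ _ _).trans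
        ((Nat.sub_le _ _).trans (Ecount_mono h0 hmono htop ha (not_le.1 hal).le))
    have h3 : (arrCount v (S ∘ U) 0 (Ecount U a) (S τ) (Set.Ioc 0 κ) : ℝ) ≤ Ecount U lam := by
      exact_mod_cast h2
    linarith
  have ha' : 0 ≤ a - lam := sub_nonneg.2 hal
  have ha'a : a - lam ≤ a := by linarith
  have hE := Ecount_mono h0 hmono htop ha' ha'a
  have hA := harr (a - lam) ⟨ha', by linarith⟩
  rw [sub_add_cancel] at hA
  have hnew : (arrCount v (S ∘ U) (Ecount U (a - lam)) (Ecount U a) (S τ) (Set.Ioc 0 κ) : ℝ)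
      ≤ A := by
    refine le_trans ?_ hA
    rw [← Nat.cast_sub hE]
    exact_mod_cast arrCount_le_sub _ _ _ _ _ _
  have hsplit := arrCount_add_arrCount v (S ∘ U) (Nat.zero_le _) hE (S τ) (Set.Ioc 0 κ)
  have hsplit' : (arrCount v (S ∘ U) 0 (Ecount U a) (S τ) (Set.Ioc 0 κ) : ℝ)
      = arrCount v (S ∘ U) 0 (Ecount U (a - lam)) (S τ) (Set.Ioc 0 κ)
        + arrCount v (S ∘ U) (Ecount U (a - lam)) (Ecount U a) (S τ) (Set.Ioc 0 κ) := by
    exact_mod_cast hsplit.symm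
  suffices hold : (initCount vt Z0 (S τ) (Set.Ioc 0 κ) : ℝ)
      + arrCount v (S ∘ U) 0 (Ecount U (a - lam)) (S τ) (Set.Ioc 0 κ) ≤ I by linarith
  have hback : ∀ s ∈ Set.Icc (a - lam) a, ∀ c : ℝ, c ≤ S τ - S s →
      (initCount vt Z0 (S τ) (Set.Ioc 0 κ) : ℝ)
        + arrCount v (S ∘ U) 0 (Ecount U (a - lam)) (S τ) (Set.Ioc 0 κ)
      ≤ initCount vt Z0 (S s) (Set.Ioi c)
        + arrCount v (S ∘ U) 0 (Ecount U s) (S s) (Set.Ioi c) := by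
    intro s hs c hc
    have hz : ∀ z ∈ Set.Ioc 0 κ, z + (S τ - S s) ∈ Set.Ioi c := fun z hz => by
      have := hz.1
      simp only [Set.mem_Ioi]
      linarith
    exact_mod_cast add_le_add (initCount_le_initCount hz)
      (arrCount_le_arrCount (Ecount_mono h0 hmono htop ha' hs.1) hz)
  by_cases hidle : ∀ s ∈ Set.Icc (a - lam) a, 0 < mass (μ s)
  · have hserv := hcases hal hidle
    have hb := hback (a - lam) ⟨le_rfl, ha'a⟩ B hserv.le
    have hm := h.mul_count_le_pair ha' hB.le
    have hw := hwork (a - lam) ⟨ha', by linarith⟩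
    exact hb.trans (le_of_mul_le_mul_left (hm.trans (hw.trans hWI)) hB)
  · push Not at hidle
    obtain ⟨s, hs, hs0⟩ := hidle
    have hb := hback s hs 0 (sub_nonneg.2 (h.service_mono hq (ha'.trans hs.1) (hs.2.trans haτ)))
    rw [h.mass_eq (ha'.trans hs.1)] at hs0
    linarith

/-- Jobs with small residual service time are few. -/
theorem small_residual_count_le {U v : ℕ → ℝ} {Z0 : ℕ} {vt : ℕ → ℝ} {μ : ℝ → Measure ℝ}
    {S : ℝ → ℝ} (hq : QueueHyps U v Z0 vt) (h : StateEqns U v Z0 vt μ S)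
    {τ lam κ A I W B C : ℝ} {f : ℕ → ℝ} (hτ : 0 ≤ τ) (hlam : 0 < lam) (hκ : 0 < κ) (hB : 0 < B)
    (hI : 0 ≤ I) (hWI : W ≤ B * I) (hκC : 2 * κ ≤ lam / C) (hf : ∀ k, 0 ≤ f k)
    (hinit : (initCount vt Z0 (S τ) (Set.Ioc 0 κ) : ℝ) ≤ I)
    (harr : ∀ b ∈ Set.Icc 0 τ, (Ecount U (b + lam) : ℝ) - Ecount U b ≤ A)
    (hwork : ∀ b ∈ Set.Icc 0 τ, pair id (μ b) ≤ W)
    (hmass : ∀ b ∈ Set.Icc 0 τ, mass (μ b) ≤ C)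
    (hbin : ∀ b ∈ Set.Icc 0 τ, ∀ k ≤ ⌈B / κ⌉₊ + 1,
      (∑ i ∈ Finset.Ioc (Ecount U b) (Ecount U (b + lam)),
        if (k : ℝ) * κ ≤ v i ∧ v i < ((k : ℝ) + 1) * κ then (1 : ℝ) else 0) ≤ f k) :
    ∃ n, (initCount vt Z0 (S τ) (Set.Ioc 0 κ) : ℝ)
      + arrCount v (S ∘ U) 0 (Ecount U τ) (S τ) (Set.Ioc 0 κ)
      ≤ I + A + 2 * ∑ k ∈ Finset.range n, f k := by
  classical
  obtain ⟨h0, hmono, -, htop, -, -⟩ := id hq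
  set a : ℕ → ℝ := fun j => τ - j * lam with ha_def
  have ha_succ : ∀ j, a (j + 1) = a j - lam := fun j => by simp only [ha_def]; push_cast; ring
  have ha0 : a 0 = τ := by simp [ha_def]
  have ha_le : ∀ j, a j ≤ τ := fun j => by
    simp only [ha_def]
    have : 0 ≤ (j : ℝ) * lam := by positivity
    linarith
  let good : ℕ → Prop := fun j =>
    lam ≤ a j ∧ (∀ s ∈ Set.Icc (a j - lam) (a j), 0 < mass (μ s)) ∧ S τ - S (a j - lam) ≤ B
  have hex : ∃ j, ¬ good j := by
    obtain ⟨n, hn⟩ := exists_nat_gt (τ / lam)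
    refine ⟨n, fun hg => ?_⟩
    have h2 := (div_lt_iff₀ hlam).1 hn
    have h3 := hg.1
    simp only [ha_def] at h3
    linarith
  obtain ⟨J, hJbad, hJgood⟩ : ∃ J, ¬ good J ∧ ∀ j < J, good j :=
    ⟨Nat.find hex, Nat.find_spec hex, fun j hj => not_not.1 (Nat.find_min hex hj)⟩
  have ha_nonneg : ∀ j ≤ J, 0 ≤ a j := by
    intro j hj
    rcases j with _ | j
    · rw [ha0]; exact hτ
    · rw [ha_succ]
      linarith [(hJgood j hj).1]
  set K : ℕ → ℕ := fun j => ⌊(S τ - S (a j)) / κ⌋₊ with hK_def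
  have hserv_nonneg : ∀ j ≤ J, 0 ≤ S τ - S (a j) := fun j hj =>
    sub_nonneg.2 (h.service_mono hq (ha_nonneg j hj) (ha_le j))
  have hK : ∀ j < J, K j + 2 ≤ K (j + 1) := by
    intro j hj
    have hg := hJgood j hj
    have hnn : 0 ≤ a j - lam := by linarith [hg.1]
    refine floor_div_add_two_le hκ (hserv_nonneg j hj.le) ?_
    have h2 := h.div_le_service_sub hq hnn (by linarith) hg.2.1
      fun s hs => hmass s ⟨hnn.trans hs.1, hs.2.trans (ha_le j)⟩
    rw [ha_succ]
    rw [sub_sub_cancel] at h2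
    linarith
  have hKB : ∀ j ≤ J, K j ≤ ⌈B / κ⌉₊ := by
    intro j hj
    refine (Nat.floor_le_ceil _).trans (Nat.ceil_le_ceil (div_le_div_of_nonneg_right ?_ hκ.le))
    rcases j with _ | j
    · rw [ha0, sub_self]; exact hB.le
    · rw [ha_succ]
      exact (hJgood j hj).2.2
  have hold := old_jobs_le hq h (ha_nonneg J le_rfl) (ha_le J) hlam hB hI hWI hinit harr hwork
    fun hl hs => not_le.1 fun hle => hJbad ⟨hl, hs, hle⟩
  have hwindow : ∀ j < J,
      (arrCount v (S ∘ U) (Ecount U (a (j + 1))) (Ecount U (a j)) (S τ) (Set.Ioc 0 κ) : ℝ)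
      ≤ ∑ k ∈ Finset.Ico (K j) (K (j + 1) + 2), f k := by
    intro j hj
    have hnn := ha_nonneg (j + 1) hj
    have hle : a (j + 1) ≤ a j := by rw [ha_succ]; linarith
    refine (arrCount_le_sum_bins hq h hnn hle (sub_nonneg.1 (hserv_nonneg j hj.le)) hκ).trans
      (Finset.sum_le_sum fun k hk => ?_)
    have hk' := (Finset.mem_Ico.1 hk).2
    have hKj : ⌊(S τ - S (a (j + 1))) / κ⌋₊ ≤ ⌈B / κ⌉₊ := hKB (j + 1) hj
    have := hbin (a (j + 1)) ⟨hnn, ha_le _⟩ k (by omega)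
    rwa [show a (j + 1) + lam = a j by rw [ha_succ]; ring] at this
  have hsum := sum_le_of_overlapping_intervals hf hK hwindow
  have hE : ∀ j < J, Ecount U (a (j + 1)) ≤ Ecount U (a j) := fun j hj =>
    Ecount_mono h0 hmono htop (ha_nonneg (j + 1) hj) (by rw [ha_succ]; linarith)
  obtain ⟨hEJ, hchain⟩ := sum_range_arrCount v (S ∘ U) (S τ) (Set.Ioc 0 κ)
    (e := fun j => Ecount U (a j)) hE
  have hsplit := arrCount_add_arrCount v (S ∘ U) (Nat.zero_le _) hEJ (S τ) (Set.Ioc 0 κ)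
  rw [← hchain, ha0] at hsplit
  have hmonoK : ∑ k ∈ Finset.range (K J), f k ≤ ∑ k ∈ Finset.range (K J + 2), f k :=
    Finset.sum_le_sum_of_subset_of_nonneg (Finset.range_subset_range.2 (by omega))
      fun _ _ _ => hf _
  refine ⟨K J + 2, ?_⟩
  rw [← hsplit]
  push_cast
  linarith

theorem exists_nat_add_mem_Icc {L x : ℝ} {m : ℕ} (hL : 1 < L) (hx : 0 ≤ x)
    (hxm : x ≤ m + L) : ∃ m' ≤ m, ∃ t ∈ Set.Icc 0 L, x = (m' : ℝ) + t := by
  by_cases hm : (m : ℝ) ≤ x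
  · exact ⟨m, le_rfl, x - m, ⟨by linarith, by linarith⟩, by ring⟩
  · have h1 := Nat.floor_le hx
    have h2 := Nat.lt_floor_add_one x
    refine ⟨⌊x⌋₊, ?_, x - ⌊x⌋₊, ⟨by linarith, by linarith⟩, by ring⟩
    exact_mod_cast h1.trans (not_le.1 hm).le

theorem mass_fmu (μ : ℝ → Measure ℝ) {r : ℝ} (hr : 0 < r) (t : ℝ) :
    mass (fmu μ r t) = mass (μ (r * t)) / r := by
  unfold mass fmu
  rw [Measure.smul_apply, smul_eq_mul, ENNReal.toReal_mul, ENNReal.toReal_ofReal (by positivity)]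
  ring

theorem pair_fmu (g : ℝ → ℝ) (μ : ℝ → Measure ℝ) {r : ℝ} (hr : 0 < r) (t : ℝ) :
    pair g (fmu μ r t) = pair g (μ (r * t)) / r := by
  unfold pair fmu
  rw [integral_smul_measure, ENNReal.toReal_ofReal (by positivity), smul_eq_mul]
  ring

end PSQ

open PSQ MeasureTheory in
/-- Lemma 3.11: small initial shifted workload forces small queue length. -/
theorem stmt_8 (α : ℝ) (hα : 0 < α) (ν : Measure ℝ) (hν : IsProbabilityMeasure ν)
    (hνsupp : ν (Set.Iio 0) = 0)
    (T L r : ℝ) (hT : 1 < T) (hL : 1 < L) (hr : 0 < r)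
    (ε l p κ γ M : ℝ) (hconsts : GoodConsts α ε l p κ γ M)
    (U v : ℕ → ℝ) (Z0 : ℕ) (vt : ℕ → ℝ) (hq : QueueHyps U v Z0 vt)
    (μ : ℝ → Measure ℝ) (S : ℝ → ℝ) (hstate : StateEqns U v Z0 vt μ S)
    (hgood : GoodPath U v μ ν T L r ε l p κ γ M)
    (m : ℕ) (hm : m ≤ ⌊r*T⌋₊)
    (hsmall : pair id (fmu μ r (m:ℝ)) ≤ γ/2) :
    ∀ t ∈ Set.Icc (0:ℝ) L, mass (fmu μ r ((m:ℝ)+t)) ≤ 2*ε := by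
  intro t ht
  obtain ⟨hε, hl, hp, hκ, hγ, hM, -, hκl, hγmin⟩ := hconsts
  have hε0 : 0 < ε := hε.1
  have hγκ : γ < κ * ε / 4 := lt_of_lt_of_le hγmin (min_le_left _ _)
  have hmt : 0 ≤ (m : ℝ) + t := add_nonneg (Nat.cast_nonneg m) ht.1
  have hτ : 0 ≤ r * ((m : ℝ) + t) := mul_nonneg hr.le hmt
  have hshift : ∀ b ∈ Set.Icc 0 (r * ((m : ℝ) + t)),
      ∃ m' ≤ ⌊r * T⌋₊, ∃ s ∈ Set.Icc 0 L, b = r * ((m' : ℝ) + s) := by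
    intro b hb
    obtain ⟨m', hm', s, hs, hbs⟩ := exists_nat_add_mem_Icc (x := b / r) (m := m) hL
      (div_nonneg hb.1 hr.le) (by rw [div_le_iff₀ hr]; nlinarith [hb.2, ht.2])
    exact ⟨m', hm'.trans hm, s, hs, by rw [← hbs]; field_simp⟩
  have harr : ∀ b ∈ Set.Icc 0 (r * ((m : ℝ) + t)),
      (Ecount U (b + r * l) : ℝ) - Ecount U b ≤ r * (ε / 16) := by
    intro b hb
    obtain ⟨m', hm', s, hs, rfl⟩ := hshift b hb
    have := (hgood m' hm').1 s hs
    unfold fE at this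
    rw [← sub_div, div_le_iff₀ hr, mul_add r (_ + _) l] at this
    linarith
  have hbound : ∀ b ∈ Set.Icc 0 (r * ((m : ℝ) + t)),
      mass (μ b) ≤ r * M ∧ pair id (μ b) ≤ r * M := by
    intro b hb
    obtain ⟨m', hm', s, hs, rfl⟩ := hshift b hb
    have := (hgood m' hm').2.1 s hs
    rw [max_le_iff, max_le_iff, mass_fmu μ hr, pair_fmu _ μ hr, div_le_iff₀ hr,
      div_le_iff₀ hr] at this
    exact ⟨by linarith [this.1.1], by linarith [this.1.2]⟩
  have hbin : ∀ b ∈ Set.Icc 0 (r * ((m : ℝ) + t)), ∀ k ≤ ⌈64 * M ^ 2 / ε ^ 2 / κ⌉₊ + 1,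
      (∑ i ∈ Finset.Ioc (Ecount U b) (Ecount U (b + r * l)),
        if (k : ℝ) * κ ≤ v i ∧ v i < ((k : ℝ) + 1) * κ then (1 : ℝ) else 0)
      ≤ r * (ε / 8)
        * (ν (Set.Ico (((k:ℝ)-1/2)*κ) (((k:ℝ)+3/2)*κ))).toReal := by
    intro b hb k hk
    obtain ⟨m', hm', s, hs, rfl⟩ := hshift b hb
    have := (hgood m' hm').2.2.2.2 s hs k (by rwa [div_div, mul_comm (ε ^ 2)] at hk)
    rw [one_div, inv_mul_le_iff₀ hr, mul_add r (_ + _) l] at this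
    linarith
  have hS : 0 ≤ S (r * ((m : ℝ) + t)) := by
    have := hstate.service_mono hq le_rfl hτ
    rwa [(hstate 0 le_rfl).1, intervalIntegral.integral_same] at this
  have hinit : (initCount vt Z0 (S (r * ((m : ℝ) + t))) (Set.Ioc 0 κ) : ℝ) ≤ r * (ε / 4) := by
    have hc := (hgood m hm).2.2.1 _ hS
    unfold fmu at hc
    rw [Measure.smul_apply, smul_eq_mul, ENNReal.toReal_mul,
      ENNReal.toReal_ofReal (by positivity), mul_zero,
      hstate.measure_toReal le_rfl measurableSet_Icc, one_div, inv_mul_le_iff₀ hr] at hc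
    have hS0 : S 0 = 0 := by rw [(hstate 0 le_rfl).1, intervalIntegral.integral_same]
    have hle : initCount vt Z0 (S (r * ((m : ℝ) + t))) (Set.Ioc 0 κ)
        ≤ initCount vt Z0 (S 0) (Set.Icc (S (r * ((m : ℝ) + t)))
          (S (r * ((m : ℝ) + t)) + κ) ∩ Set.Ioi 0) := by
      refine initCount_le_initCount fun z hz => ?_
      have hz1 := hz.1
      have hz2 := hz.2
      rw [hS0]
      exact ⟨⟨by linarith, by linarith⟩, Set.mem_Ioi.2 (by linarith)⟩
    have hle' : (initCount vt Z0 (S (r * ((m : ℝ) + t))) (Set.Ioc 0 κ) : ℝ)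
        ≤ initCount vt Z0 (S 0) (Set.Icc (S (r * ((m : ℝ) + t)))
          (S (r * ((m : ℝ) + t)) + κ) ∩ Set.Ioi 0) := by exact_mod_cast hle
    refine le_trans (hle'.trans ?_) hc
    exact le_add_of_nonneg_right (Nat.cast_nonneg _)
  obtain ⟨n, hn⟩ := small_residual_count_le hq hstate (A := r * (ε / 16)) (I := r * (ε / 4))
    (W := r * M) (B := 64 * M ^ 2 / ε ^ 2) (C := r * M) hτ (mul_pos hr hl) hκ (by positivity)
    (by positivity)
    (by
      rw [show 64 * M ^ 2 / ε ^ 2 * (r * (ε / 4)) = r * M * (16 * M / ε) by field_simp; ring]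
      refine le_mul_of_one_le_right (by positivity) ?_
      rw [one_le_div hε0]
      linarith [hε.2])
    (by
      rw [mul_div_mul_left _ _ hr.ne']
      have := (lt_div_iff₀ (by positivity)).1 hκl
      rw [le_div_iff₀ (by positivity)]
      linarith)
    (fun k => by positivity) hinit harr (fun b hb => (hbound b hb).2)
    (fun b hb => (hbound b hb).1) hbin
  rw [← Finset.mul_sum] at hn
  have hwin := mul_le_mul_of_nonneg_left (sum_measure_windows_le_two ν hκ n)
    (show 0 ≤ r * (ε / 8) by positivity)
  have hlarge : (initCount vt Z0 (S (r * ((m : ℝ) + t))) (Set.Ioi κ) : ℝ)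
      + arrCount v (S ∘ U) 0 (Ecount U (r * ((m : ℝ) + t))) (S (r * ((m : ℝ) + t))) (Set.Ioi κ)
      ≤ r * (3 * ε / 16) := by
    have hw := (abs_le.1 ((hgood m hm).2.2.2.1 t ht)).2
    have hw' : pair id (fmu μ r ((m : ℝ) + t)) ≤ κ * (3 * ε / 16) := by linarith
    rw [pair_fmu _ μ hr, div_le_iff₀ hr] at hw'
    refine le_of_mul_le_mul_left ((hstate.mul_count_le_pair hτ hκ.le).trans ?_) hκ
    linarith
  have hcover : Set.Ioi (0 : ℝ) ⊆ Set.Ioc 0 κ ∪ Set.Ioi κ := by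
    rw [Set.Ioc_union_Ioi_eq_Ioi hκ.le]
  have hi : (initCount vt Z0 (S (r * ((m : ℝ) + t))) (Set.Ioi 0) : ℝ) ≤ _ :=
    Nat.cast_le.2 (initCount_le_union hcover)
  have hj : (arrCount v (S ∘ U) 0 (Ecount U (r * ((m : ℝ) + t))) (S (r * ((m : ℝ) + t)))
      (Set.Ioi 0) : ℝ) ≤ _ := Nat.cast_le.2 (arrCount_le_union hcover)
  push_cast at hi hj
  rw [mass_fmu μ hr, hstate.mass_eq hτ, div_le_iff₀ hr]
  have hrε : 0 < r * ε := mul_pos hr hε0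
  linarith
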